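/- arXiv:2007.08358 — 2 statements merged into one kernel-verified Lean document; each statement's English description precedes it below -/
import Mathlib

section
/- For every integer n ≥ 1 and every integer m ≥ 1, the Ramanujan tau function satisfies τ(n) ≠ 5^m and τ(n) ≠ −5^m. -/
/-- The Ramanujan tau function: `τ(n)` is the coefficient of `qⁿ` in
`q ∏_{i≥1} (1 - qⁱ)²⁴`. Since factors with `i > n` do not affect the
coefficient of `qⁿ`, it suffices to truncate the product at `i = n`. -/
noncomputable def ramanujanTau (n : ℕ) : ℤ :=
  (Polynomial.X * ∏ i ∈ Finset.range n, (1 - Polynomial.X ^ (i + 1)) ^ 24 :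
    Polynomial ℤ).coeff n

/-- The Lucas sequence `U_n(A, P)` of the first kind. -/
def lucasU (A P : ℤ) : ℕ → ℤ
  | 0 => 0
  | 1 => 1
  | n + 2 => A * lucasU A P (n + 1) - P * lucasU A P n

@[simp] lemma lucasU_zero (A P : ℤ) : lucasU A P 0 = 0 := rfl

@[simp] lemma lucasU_one (A P : ℤ) : lucasU A P 1 = 1 := rfl

lemma lucasU_add_two (A P : ℤ) (n : ℕ) :
    lucasU A P (n + 2) = A * lucasU A P (n + 1) - P * lucasU A P n := rfl

lemma lucasU_add_add_one (A P : ℤ) (m n : ℕ) :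
    lucasU A P (m + n + 1) =
      lucasU A P (m + 1) * lucasU A P (n + 1) - P * lucasU A P m * lucasU A P n := by
  induction n using Nat.twoStepInduction with
  | zero => simp
  | one => simp [lucasU_add_two]; ring
  | more n h1 h2 =>
    rw [show m + (n + 2) + 1 = (m + n + 1) + 2 by ring, lucasU_add_two,
      show m + n + 1 + 1 = m + (n + 1) + 1 by ring, h1, h2, lucasU_add_two A P (n + 1),
      lucasU_add_two A P n]
    ring

lemma lucasU_dvd_lucasU_mul (A P : ℤ) (m k : ℕ) : lucasU A P m ∣ lucasU A P (m * k) := by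
  induction k with
  | zero => simp
  | succ k ih =>
    obtain _ | m := m
    · simp
    · rw [show (m + 1) * (k + 1) = (m + 1) * k + m + 1 by ring, lucasU_add_add_one]
      exact dvd_sub (dvd_mul_left _ _) ((ih.mul_left _).mul_right _)

lemma lucasU_smul (c A P : ℤ) (n : ℕ) :
    lucasU (c * A) (c ^ 2 * P) (n + 1) = c ^ n * lucasU A P (n + 1) := by
  induction n using Nat.twoStepInduction with
  | zero => simp
  | one => simp [lucasU_add_two]
  | more n h1 h2 =>
    rw [show n + 2 + 1 = (n + 1) + 2 by ring, lucasU_add_two, h1, h2, lucasU_add_two A P (n + 1)]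
    ring

lemma lucasU_modEq {A A' P P' m : ℤ} (hA : A ≡ A' [ZMOD m]) (hP : P ≡ P' [ZMOD m]) (n : ℕ) :
    lucasU A P n ≡ lucasU A' P' n [ZMOD m] := by
  induction n using Nat.twoStepInduction with
  | zero => rfl
  | one => rfl
  | more n h1 h2 => exact (hA.mul h2).sub (hP.mul h1)

lemma two_dvd_lucasU_two_mul {A P : ℤ} (hA : Even A) (k : ℕ) : 2 ∣ lucasU A P (2 * k) :=
  (show (2 : ℤ) ∣ lucasU A P 2 by simpa [lucasU_add_two] using hA.two_dvd).trans
    (lucasU_dvd_lucasU_mul A P 2 k)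

lemma lucasU_two_one (n : ℕ) : lucasU 2 1 n = n := by
  induction n using Nat.twoStepInduction with
  | zero => rfl
  | one => rfl
  | more n h1 h2 => rw [lucasU_add_two, h1, h2]; push_cast; ring

/-- If `5 ∣ U₄` but `5 ∤ U₃` and `5 ∤ P`, then `5` divides no term of odd index. -/
lemma not_five_dvd_lucasU_odd {A P : ℤ} (h4 : (5 : ℤ) ∣ lucasU A P 4)
    (hP : ¬ (5 : ℤ) ∣ P) (h3 : ¬ (5 : ℤ) ∣ lucasU A P 3) (k : ℕ) :
    ¬ (5 : ℤ) ∣ lucasU A P (2 * k + 1) := by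
  have h5 : Prime (5 : ℤ) := by norm_num
  induction k using Nat.twoStepInduction with
  | zero => norm_num
  | one => exact h3
  | more k h _ =>
    rw [show 2 * (k + 2) + 1 = 3 + (2 * k + 1) + 1 by ring, lucasU_add_add_one]
    intro hd
    have := (Int.dvd_iff_dvd_of_dvd_sub hd).mp (h4.mul_right _)
    rcases h5.dvd_or_dvd this with h' | h'
    · exact (h5.dvd_or_dvd h').elim hP h3
    · exact h h'

lemma modEq_one_and_dvd_of_five_dvd_lucasU {p A : ℤ} (hp : ¬ (5 : ℤ) ∣ p)
    (hA : A ≡ p * (1 + p) [ZMOD 5]) (k : ℕ) (h : (5 : ℤ) ∣ lucasU A (p ^ 11) (2 * k + 1)) :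
    p ≡ 1 [ZMOD 5] ∧ 5 ∣ 2 * k + 1 := by
  have key (r a b : ℤ) (hr : p ≡ r [ZMOD 5]) (ha : r * (1 + r) ≡ a [ZMOD 5])
      (hb : r ^ 11 ≡ b [ZMOD 5]) : (5 : ℤ) ∣ lucasU a b (2 * k + 1) :=
    ((lucasU_modEq ((hA.trans (hr.mul (hr.add_left 1))).trans ha)
      ((hr.pow 11).trans hb) _).dvd_iff).mp h
  have h5 : p % 5 = 0 ∨ p % 5 = 1 ∨ p % 5 = 2 ∨ p % 5 = 3 ∨ p % 5 = 4 := by omega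
  rcases h5 with h5 | h5 | h5 | h5 | h5
  · exact absurd (Int.dvd_of_emod_eq_zero h5) hp
  · refine ⟨h5, ?_⟩
    have := key 1 2 1 h5 (by decide) (by decide)
    rw [lucasU_two_one] at this
    exact_mod_cast this
  · exact absurd (key 2 1 3 h5 (by decide) (by decide))
      (not_five_dvd_lucasU_odd (by decide) (by decide) (by decide) k)
  · exact absurd (key 3 2 2 h5 (by decide) (by decide))
      (not_five_dvd_lucasU_odd (by decide) (by decide) (by decide) k)
  · exact absurd (key 4 0 (-1) h5 (by decide) (by decide))
      (not_five_dvd_lucasU_odd (by decide) (by decide) (by decide) k)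

lemma lucasU_five (A P : ℤ) : lucasU A P 5 = P ^ 2 - 3 * A ^ 2 * P + A ^ 4 := by
  simp [lucasU]; ring

/-- The Lucas numbers `2, 1, 3, 4, 7, 11, …`. -/
def lucasL : ℕ → ℤ
  | 0 => 2
  | 1 => 1
  | n + 2 => lucasL (n + 1) + lucasL n

lemma lucasL_add_two (n : ℕ) : lucasL (n + 2) = lucasL (n + 1) + lucasL n := rfl

lemma lucasL_mul_lucasL (k n : ℕ) :
    lucasL k * lucasL (n + k) = lucasL (n + 2 * k) + (-1) ^ k * lucasL n := by
  induction k using Nat.twoStepInduction generalizing n with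
  | zero => simp [lucasL]; ring
  | one => simp [lucasL]
  | more k h1 h2 =>
    have h1 := h1 (n + 2)
    have h2 := h2 (n + 1)
    rw [show n + 2 + k = n + (k + 2) by ring] at h1
    rw [show n + 1 + (k + 1) = n + (k + 2) by ring] at h2
    rw [lucasL_add_two k, add_mul, h1, h2, show n + 2 * (k + 2) = n + 2 * k + 2 + 2 by ring,
      lucasL_add_two (n + 2 * k + 2), show n + 1 + 2 * (k + 1) = n + 2 * k + 2 + 1 by ring,
      show n + 2 + 2 * k = n + 2 * k + 2 by ring, lucasL_add_two n]
    ring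

lemma lucasL_dvd_add_of_odd {k s : ℕ} (hk : Even k) (hs : Odd s) (n : ℕ) :
    lucasL k ∣ lucasL (n + 2 * k * s) + lucasL n := by
  have step (n : ℕ) : lucasL k ∣ lucasL (n + 2 * k) + lucasL n :=
    ⟨lucasL (n + k), by rw [lucasL_mul_lucasL, hk.neg_one_pow, one_mul]⟩
  obtain ⟨j, rfl⟩ := hs
  induction j with
  | zero => simpa using step n
  | succ j ih =>
    rw [show n + 2 * k * (2 * (j + 1) + 1) = n + 2 * k * (2 * j + 1) + 2 * k + 2 * k by ring]
    have h := (step (n + 2 * k * (2 * j + 1) + 2 * k)).sub (step (n + 2 * k * (2 * j + 1)))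
    exact (h.add ih).trans (by ring_nf; rfl)

lemma lucasL_two_pow_emod_four (r : ℕ) : lucasL (2 ^ (r + 1)) % 4 = 3 := by
  induction r with
  | zero => decide
  | succ r ih =>
    have h := lucasL_mul_lucasL (2 ^ (r + 1)) 0
    rw [(even_two.pow_of_ne_zero r.succ_ne_zero).neg_one_pow, zero_add, zero_add, ← pow_succ'] at h
    rw [show lucasL (2 ^ (r + 1 + 1)) = lucasL (2 ^ (r + 1)) * lucasL (2 ^ (r + 1)) - 2 by
      rw [h]; simp [lucasL], Int.sub_emod, Int.mul_emod, ih]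
    rfl

lemma lucasL_pos (n : ℕ) : 0 < lucasL n := by
  induction n using Nat.twoStepInduction with
  | zero => decide
  | one => decide
  | more n h1 h2 => rw [lucasL_add_two]; positivity

lemma not_dvd_sq_add_one_of_emod_four_eq_three {d : ℤ} (hd : 0 < d) (h3 : d % 4 = 3) (b : ℤ) :
    ¬ d ∣ b ^ 2 + 1 := by
  lift d to ℕ using hd.le
  intro h
  have h1 : ((b ^ 2 + 1 : ℤ) : ZMod d) = 0 := (ZMod.intCast_zmod_eq_zero_iff_dvd _ _).mpr h
  have h2 : IsSquare (-1 : ZMod d) := ⟨b, by push_cast at h1; linear_combination -h1⟩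
  obtain ⟨x, y, hxy⟩ := Nat.eq_sq_add_sq_of_isSquare_mod_neg_one h2
  have key : ∀ n : ℕ, n ^ 2 % 4 = 0 ∨ n ^ 2 % 4 = 1 := fun n ↦ by
    have : n % 4 = 0 ∨ n % 4 = 1 ∨ n % 4 = 2 ∨ n % 4 = 3 := by omega
    rcases this with h | h | h | h <;> simp [Nat.pow_mod, h]
  have := key x
  have := key y
  omega

lemma lucasL_succ_and_fib_succ (n : ℕ) :
    2 * lucasL (n + 1) = lucasL n + 5 * Nat.fib n ∧
      2 * (Nat.fib (n + 1) : ℤ) = Nat.fib n + lucasL n := by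
  induction n with
  | zero => simp [lucasL]
  | succ n ih =>
    rw [lucasL_add_two, Nat.fib_add_two]
    push_cast
    constructor <;> linarith [ih.1, ih.2]

/-- Every solution of `x² + 1 = 5 w²` comes from the Lucas and Fibonacci numbers. -/
lemma exists_lucasL_of_sq_add_one {x w : ℕ} (h : x ^ 2 + 1 = 5 * w ^ 2) :
    ∃ t, (2 * x : ℤ) = lucasL (6 * t + 3) ∧ (2 * w : ℤ) = Nat.fib (6 * t + 3) := by
  induction w using Nat.strong_induction_on generalizing x with
  | _ w ih =>
  by_cases hw : w < 5
  · have hx : x < 10 := by nlinarith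
    interval_cases w <;> interval_cases x <;> first | omega | exact ⟨0, by decide, by decide⟩
  · push Not at hw
    have h1 : 20 * w ≤ 9 * x := by nlinarith
    have h2 : 4 * x ≤ 9 * w := by nlinarith
    have h3 : 2 * w < x := by nlinarith
    obtain ⟨t, ht, ht'⟩ := ih (9 * w - 4 * x) (by omega) (x := 9 * x - 20 * w) (by
      zify [h1, h2] at h ⊢
      linear_combination h)
    zify [h1, h2] at ht ht'
    obtain ⟨a0, b0⟩ := lucasL_succ_and_fib_succ (6 * t + 3)
    obtain ⟨a1, b1⟩ := lucasL_succ_and_fib_succ (6 * t + 4)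
    obtain ⟨a2, b2⟩ := lucasL_succ_and_fib_succ (6 * t + 5)
    obtain ⟨a3, b3⟩ := lucasL_succ_and_fib_succ (6 * t + 6)
    obtain ⟨a4, b4⟩ := lucasL_succ_and_fib_succ (6 * t + 7)
    obtain ⟨a5, b5⟩ := lucasL_succ_and_fib_succ (6 * t + 8)
    exact ⟨t + 1, by rw [show 6 * (t + 1) + 3 = 6 * t + 8 + 1 by ring]; linarith,
      by rw [show 6 * (t + 1) + 3 = 6 * t + 8 + 1 by ring]; linarith⟩

/-- **Cohn**: the only even square among the Lucas numbers of odd index is `4`. -/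
lemma eq_four_of_sq_eq_lucasL {A : ℤ} (hA : Even A) {t : ℕ} (h : A ^ 2 = lucasL (2 * t + 1)) :
    A ^ 2 = 4 := by
  obtain ⟨s, n, hn, ht⟩ : ∃ s n, (n = 1 ∨ n = 3) ∧ 2 * t + 1 = n + 4 * s :=
    ⟨t / 2, 2 * (t % 2) + 1, by omega, by omega⟩
  rw [ht] at h
  rcases Nat.eq_zero_or_pos s with rfl | hs
  · rcases hn with rfl | rfl
    · rw [h]
      have := hA.pow_of_ne_zero two_ne_zero
      rw [h] at this
      exact absurd this (by decide)
    · rw [h]; rfl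
  · obtain ⟨r, u, hu, rfl⟩ := Nat.exists_eq_two_pow_mul_odd hs.ne'
    have hdvd := lucasL_dvd_add_of_odd (k := 2 ^ (r + 1)) (even_two.pow_of_ne_zero r.succ_ne_zero)
      hu n
    rw [show n + 2 * 2 ^ (r + 1) * u = n + 4 * (2 ^ r * u) by ring, ← h] at hdvd
    have h4 := lucasL_two_pow_emod_four r
    rcases hn with rfl | rfl
    · exact (not_dvd_sq_add_one_of_emod_four_eq_three (lucasL_pos _) h4 _ hdvd).elim
    · obtain ⟨b, rfl⟩ := hA
      rw [show (b + b) ^ 2 + lucasL 3 = 2 * (2 * (b ^ 2 + 1)) by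
        rw [show lucasL 3 = 4 from rfl]; ring] at hdvd
      have hc : IsCoprime (lucasL (2 ^ (r + 1))) 2 :=
        ⟨-1, (lucasL (2 ^ (r + 1)) + 1) / 2, by omega⟩
      exact absurd (hc.dvd_of_dvd_mul_left (hc.dvd_of_dvd_mul_left hdvd))
        (not_dvd_sq_add_one_of_emod_four_eq_three (lucasL_pos _) h4 _)

lemma lucasU_five_ne_five {A P : ℤ} (hA : Even A) (hP : 11 < P) : lucasU A P 5 ≠ 5 := by
  rw [lucasU_five]
  intro h
  have hsq : (2 * P - 3 * A ^ 2) ^ 2 = 5 * (A ^ 4 + 4) := by linear_combination 4 * h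
  obtain ⟨w, hw⟩ := (show Prime (5 : ℤ) by norm_num).dvd_of_dvd_pow ⟨_, hsq⟩
  obtain ⟨a, rfl⟩ := hA.two_dvd
  have hw2 : 5 * w ^ 2 = 16 * a ^ 4 + 4 := by
    rw [hw] at hsq; linarith
  obtain ⟨v, rfl⟩ : (2 : ℤ) ∣ w := by
    have h2 : (2 : ℤ) ∣ 5 * w ^ 2 := ⟨8 * a ^ 4 + 2, by rw [hw2]; ring⟩
    exact Int.prime_two.dvd_of_dvd_pow (IsCoprime.dvd_of_dvd_mul_left ⟨-2, 1, by norm_num⟩ h2)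
  obtain ⟨t, ht, -⟩ := exists_lucasL_of_sq_add_one (x := 2 * a.natAbs ^ 2) (w := v.natAbs) (by
    zify
    simp only [sq_abs]
    linarith)
  have h4 := eq_four_of_sq_eq_lucasL (A := 2 * a) (even_two_mul a) (t := 3 * t + 1) (by
    rw [show 2 * (3 * t + 1) + 1 = 6 * t + 3 by ring, ← ht]
    push_cast
    rw [sq_abs]
    ring)
  have ha : a ^ 2 = 1 := by linarith
  have hv : v ^ 2 = 1 := by
    have : a ^ 4 = 1 := by rw [show a ^ 4 = (a ^ 2) ^ 2 by ring, ha]; norm_num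
    linarith
  rcases sq_eq_one_iff.mp hv with rfl | rfl <;> linarith

/-- If `p ≠ 5` is an odd prime, no term of the sequence `U_n(A, p¹¹)` attached to `τ(p) = A` is a
nontrivial power of five up to sign. -/
lemma eq_zero_of_natAbs_lucasU_eq_five_pow {p A : ℤ} (hp1 : 1 < p) (hp5 : ¬ (5 : ℤ) ∣ p)
    (hA2 : Even A) (hA : A ≡ p * (1 + p) [ZMOD 5]) {n j : ℕ}
    (h : (lucasU A (p ^ 11) (n + 1)).natAbs = 5 ^ j) : j = 0 := by
  by_contra hj
  have hdvd : (5 : ℤ) ∣ lucasU A (p ^ 11) (n + 1) :=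
    Int.natCast_dvd.mpr (h ▸ dvd_pow_self 5 hj)
  obtain ⟨k, rfl | rfl⟩ := Nat.even_or_odd' n
  · obtain ⟨hp, m, hm⟩ := modEq_one_and_dvd_of_five_dvd_lucasU hp5 hA k hdvd
    have hA' : A ≡ 2 [ZMOD 5] := hA.trans (hp.mul (hp.add_left 1))
    obtain ⟨i, -, hi⟩ := (Nat.dvd_prime_pow Nat.prime_five).mp
      (h ▸ hm ▸ Int.natAbs_dvd_natAbs.mpr (lucasU_dvd_lucasU_mul A (p ^ 11) 5 m))
    have hU : lucasU A (p ^ 11) 5 ≡ 5 [ZMOD 25] := by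
      obtain ⟨a, ha⟩ := hA'.symm.dvd
      obtain ⟨b, hb⟩ := (hp.pow 11).symm.dvd
      rw [one_pow] at hb
      rw [lucasU_five, eq_add_of_sub_eq ha, eq_add_of_sub_eq hb]
      exact (Int.modEq_iff_dvd.mpr ⟨5 * b ^ 2 + 2 * b + (5 * b + 1) * (5 * a ^ 2 + 4 * a - 4 * b) +
        (5 * a ^ 2 + 4 * a - 4 * b) ^ 2, by ring⟩).symm
    refine lucasU_five_ne_five hA2 (P := p ^ 11) ?_ ?_
    · exact lt_of_lt_of_le (by norm_num) (pow_le_pow_left₀ (by norm_num) hp1 11)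
    · unfold Int.ModEq at hU
      match i, hi with
      | 0, hi => omega
      | 1, hi => omega
      | i + 2, hi => rw [pow_add] at hi; omega
  · have h2 := two_dvd_lucasU_two_mul (P := p ^ 11) hA2 (k + 1)
    rw [show 2 * (k + 1) = 2 * k + 1 + 1 by ring] at h2
    have := h ▸ Int.natCast_dvd.mp h2
    exact absurd (Nat.prime_two.dvd_of_dvd_pow this) (by norm_num)

lemma exists_one_add_seven_mul_X_pow {k : ℕ} (hk : k ≠ 0) :
    ∃ (e : ℕ) (t : ℤ) (C : Polynomial ℤ), ¬ 7 ∣ t ∧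
      (1 + 7 * Polynomial.X) ^ k = 1 + 7 ^ (e + 1) * (t • Polynomial.X + 7 * C) := by
  induction k using Nat.strong_induction_on with
  | _ k ih =>
  by_cases h7 : 7 ∣ k
  · obtain ⟨k, rfl⟩ := h7
    obtain ⟨e, t, C, ht, h⟩ := ih k (by omega) (by omega)
    set Y : Polynomial ℤ := t • Polynomial.X + 7 * C with hY
    set y : Polynomial ℤ := 7 ^ (e + 1) with hy
    refine ⟨e + 1, t, C + (7 ^ e * (3 * Y ^ 2 + 5 * y * Y ^ 3 + 5 * y ^ 2 * Y ^ 4 +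
      3 * y ^ 3 * Y ^ 5 + y ^ 4 * Y ^ 6 + 7 ^ e * y ^ 4 * Y ^ 7)), ht, ?_⟩
    rw [mul_comm 7 k, pow_mul, h, mul_add 7 C, ← add_assoc, ← hY, pow_succ' 7 (e + 1), ← hy]
    simp only [show y = 7 * 7 ^ e from pow_succ' 7 e]
    ring
  · have (k : ℕ) : ∃ C : Polynomial ℤ,
        (1 + 7 * Polynomial.X : Polynomial ℤ) ^ k = 1 + 7 * ((k : ℤ) • Polynomial.X + 7 * C) := by
      induction k with
      | zero => exact ⟨0, by simp⟩
      | succ k ih =>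
        obtain ⟨C, hC⟩ := ih
        refine ⟨C + (k : Polynomial ℤ) * Polynomial.X ^ 2 + 7 * C * Polynomial.X, ?_⟩
        rw [pow_succ, hC]
        simp only [zsmul_eq_mul]
        push_cast
        ring
    obtain ⟨C, hC⟩ := this k
    exact ⟨0, k, C, by exact_mod_cast h7, by simpa using hC⟩

lemma companion_pow (A P : ℤ) (n : ℕ) :
    !![A, -P; 1, 0] ^ (n + 1) = !![lucasU A P (n + 2), -P * lucasU A P (n + 1);
      lucasU A P (n + 1), -P * lucasU A P n] := by
  induction n with
  | zero => simp [lucasU_add_two]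
  | succ n ih =>
    rw [pow_succ', ih, lucasU_add_two A P (n + 1)]
    ext i j
    fin_cases i <;> fin_cases j <;> simp [Matrix.mul_apply, Fin.sum_univ_two, lucasU_add_two] <;>
      ring

lemma lucasU_seven_adic_ne_one {k : ℕ} (hk : k ≠ 0) : lucasU 966 (5 ^ 9) (2 * k + 1) ≠ 1 := by
  obtain ⟨e, t, C, ht, h⟩ := exists_one_add_seven_mul_X_pow hk
  intro h1
  set B : Matrix (Fin 2) (Fin 2) ℤ := !![-145710, -269531250; 138, -279018] with hB
  have hM : !![966, -5 ^ 9; 1, 0] ^ 2 = 1 + 7 * B := by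
    ext i j
    fin_cases i <;> fin_cases j <;>
      simp [hB, sq, Matrix.mul_apply, Fin.sum_univ_two, Matrix.ofNat_apply]
  have := congrArg (fun Q ↦ Polynomial.aeval B Q 0 0) h
  simp only [map_pow, map_add, map_mul, map_one, Polynomial.aeval_X, map_ofNat, map_zsmul] at this
  obtain ⟨k, rfl⟩ := Nat.exists_eq_succ_of_ne_zero hk
  rw [← hM, ← pow_mul, show 2 * k.succ = 2 * k + 1 + 1 from rfl, companion_pow] at this
  rw [show 2 * k.succ + 1 = 2 * k + 1 + 2 from rfl] at h1
  generalize Polynomial.aeval B C = C' at this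
  have h7 : (7 : Matrix (Fin 2) (Fin 2) ℤ) = (7 : ℤ) • 1 := by simp
  rw [h7, smul_pow, one_pow, smul_one_mul, smul_one_mul] at this
  have h0 : t * -145710 + 7 * C' 0 0 = 0 := by
    simp only [Matrix.add_apply, Matrix.smul_apply, smul_eq_mul, Matrix.one_apply_eq, hB,
      Matrix.of_apply, Matrix.cons_val_zero, h1] at this
    simpa using this
  omega

lemma natAbs_lucasU_at_five_ne_five_pow {n j : ℕ} (hn : n ≠ 0) :
    (lucasU 4830 (5 ^ 11) (n + 1)).natAbs ≠ 5 ^ j := by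
  intro h
  rw [show (4830 : ℤ) = 5 * 966 by norm_num, show (5 ^ 11 : ℤ) = 5 ^ 2 * 5 ^ 9 by norm_num,
    lucasU_smul, Int.natAbs_mul] at h
  obtain ⟨i, -, hi⟩ := (Nat.dvd_prime_pow Nat.prime_five).mp
    ((Dvd.intro_left _ h : (lucasU 966 (5 ^ 9) (n + 1)).natAbs ∣ 5 ^ j))
  have h5 : lucasU 966 (5 ^ 9) (n + 1) ≡ 1 [ZMOD 5] := by
    refine (lucasU_modEq (A' := 1) (P' := 0) (by decide) (by decide) _).trans ?_
    have (n : ℕ) : lucasU 1 0 (n + 1) = 1 := by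
      induction n with
      | zero => rfl
      | succ n ih => rw [lucasU_add_two, ih]; ring
    rw [this]
  obtain rfl : i = 0 := by
    unfold Int.ModEq at h5
    match i, hi with
    | 0, hi => rfl
    | i + 1, hi =>
      exact absurd (Int.natCast_dvd.mpr (hi ▸ dvd_pow_self 5 i.succ_ne_zero)) (by push_cast; omega)
  obtain ⟨k, rfl | rfl⟩ := Nat.even_or_odd' n
  · have h7 : lucasU 966 (5 ^ 9) (2 * k + 1) ≡ 1 [ZMOD 7] := by
      refine (lucasU_modEq (A' := 0) (P' := -1) (by decide) (by decide) _).trans ?_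
      have (k : ℕ) : lucasU 0 (-1) (2 * k + 1) = 1 := by
        induction k with
        | zero => rfl
        | succ k ih => rw [show 2 * (k + 1) + 1 = 2 * k + 1 + 2 by ring, lucasU_add_two, ih]; ring
      rw [this]
    refine lucasU_seven_adic_ne_one (k := k) (by omega) ?_
    unfold Int.ModEq at h7
    omega
  · have h2 := two_dvd_lucasU_two_mul (A := 966) (P := 5 ^ 9) (by decide) (k + 1)
    rw [show 2 * (k + 1) = 2 * k + 1 + 1 by ring] at h2
    omega

open Filter Topology in
lemma TendstoLocallyUniformlyOn.tendsto_iteratedDeriv {F : ℕ → ℂ → ℂ} {f : ℂ → ℂ} {U : Set ℂ}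
    (hU : IsOpen U) (hF : ∀ n, Differentiable ℂ (F n))
    (hf : TendstoLocallyUniformlyOn F f atTop U) {z : ℂ} (hz : z ∈ U) (k : ℕ) :
    Tendsto (fun n ↦ iteratedDeriv k (F n) z) atTop (𝓝 (iteratedDeriv k f z)) := by
  induction k generalizing F f with
  | zero => simpa using hf.tendsto_at hz
  | succ k ih =>
    simp_rw [iteratedDeriv_succ']
    exact ih (fun n ↦ (hF n).deriv) (hf.deriv (.of_forall fun n ↦ (hF n).differentiableOn) hU)

lemma Polynomial.iteratedDeriv_eval_zero (p : Polynomial ℂ) (k : ℕ) :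
    iteratedDeriv k (fun z ↦ p.eval z) 0 = k.factorial * p.coeff k := by
  have (p : Polynomial ℂ) :
      iteratedDeriv k (fun z ↦ p.eval z) = fun z ↦ (derivative^[k] p).eval z := by
    induction k generalizing p with
    | zero => simp
    | succ k ih =>
      rw [iteratedDeriv_succ', Function.iterate_succ_apply, ← ih]
      congr 1
      ext z
      exact p.deriv
  simp only [this]
  rw [← Polynomial.coeff_zero_eq_eval_zero, Polynomial.coeff_iterate_derivative, zero_add,
    Nat.descFactorial_self, nsmul_eq_mul]

lemma coeff_truncated_product (n k : ℕ) :
    (Polynomial.X * ∏ i ∈ Finset.range (n + k), (1 - Polynomial.X ^ (i + 1)) ^ 24 :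
      Polynomial ℤ).coeff n = ramanujanTau n := by
  induction k with
  | zero => rfl
  | succ k ih =>
    rw [← ih, ← add_assoc, Finset.prod_range_succ, ← mul_assoc]
    obtain ⟨r, hr⟩ : (Polynomial.X ^ (n + k + 1) : Polynomial ℤ) ∣
        (1 - Polynomial.X ^ (n + k + 1)) ^ 24 - 1 := by
      have := sub_dvd_pow_sub_pow (1 - Polynomial.X ^ (n + k + 1) : Polynomial ℤ) 1 24
      rwa [sub_sub_cancel_left, neg_dvd, one_pow] at this
    rw [eq_add_of_sub_eq hr, mul_add, mul_one, mul_left_comm, Polynomial.coeff_add,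
      Polynomial.coeff_X_pow_mul', if_neg (by omega), zero_add]

open Filter Topology Metric UpperHalfPlane ModularForm in
/-- The `q`-expansion of the modular discriminant is the generating function of `τ`. -/
lemma discriminant_qExpansion_coeff (n : ℕ) :
    (qExpansion 1 discriminant).coeff n = (ramanujanTau n : ℂ) := by
  have h1 : TendstoLocallyUniformlyOn (fun N (q : ℂ) ↦ ∏ i ∈ Finset.range N, (1 - q ^ (i + 1)))
      (fun q ↦ ∏' i, (1 - q ^ (i + 1))) atTop (ball 0 1) :=
    multipliableLocallyUniformlyOn_one_sub_pow.hasProdLocallyUniformlyOn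
      |>.tendstoLocallyUniformlyOn_finsetRange
  have hc := differentiableOn_tprod_one_sub_pow.continuousOn
  have hconst (g : ℂ → ℂ) : TendstoLocallyUniformlyOn (fun (_ : ℕ) ↦ g) g atTop (ball 0 1) :=
    fun u hu _ _ ↦ ⟨_, self_mem_nhdsWithin, .of_forall fun _ _ _ ↦ refl_mem_uniformity hu⟩
  have hpow (k : ℕ) : TendstoLocallyUniformlyOn
      (fun N (q : ℂ) ↦ (∏ i ∈ Finset.range N, (1 - q ^ (i + 1))) ^ k)
      (fun q ↦ (∏' i, (1 - q ^ (i + 1))) ^ k) atTop (ball 0 1) := by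
    induction k with
    | zero => simpa using hconst _
    | succ k ih => simpa only [pow_succ] using ih.fun_mul₀ h1 (hc.pow k) hc
  have h2 : TendstoLocallyUniformlyOn (fun N (q : ℂ) ↦ ((Polynomial.X *
      ∏ i ∈ Finset.range N, (1 - Polynomial.X ^ (i + 1)) ^ 24 : Polynomial ℤ).map
        (Int.castRingHom ℂ)).eval q) (cuspFunction 1 discriminant) atTop (ball 0 1) := by
    refine (((hconst id).fun_mul₀ (hpow 24) continuousOn_id (hc.pow 24)).congr ?_).congr_right ?_
    · intro N q _
      simp [Polynomial.eval_prod, Polynomial.map_prod, Finset.prod_pow]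
    · intro q hq
      rw [discriminant_cuspFunction_eqOn hq]
      simp only
      rw [(multipliable_one_sub_pow (by simpa using hq)).tprod_pow 24, id]
  have h3 := h2.tendsto_iteratedDeriv isOpen_ball (fun N ↦ Polynomial.differentiable _)
    (mem_ball_self one_pos) n
  have h4 := tendsto_nhds_unique h3 (tendsto_const_nhds.congr' (f₁ := fun _ ↦
    (n.factorial * ramanujanTau n : ℂ)) ?_)
  · rw [qExpansion_coeff, h4, inv_mul_cancel_left₀ (by exact_mod_cast n.factorial_ne_zero)]
  · filter_upwards [eventually_ge_atTop n] with N hN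
    obtain ⟨k, rfl⟩ := Nat.exists_eq_add_of_le hN
    rw [Polynomial.iteratedDeriv_eval_zero, Polynomial.coeff_map, coeff_truncated_product]
    rfl

lemma ramanujanTau_one : ramanujanTau 1 = 1 := by
  have := discriminant_qExpansion_coeff 1
  rw [ModularForm.discriminant_qExpansion_coeff_one] at this
  exact_mod_cast this.symm

open UpperHalfPlane ModularForm MatrixGroups Manifold in
/-- A weight 12 level 1 form vanishing at the cusp is a multiple of `Δ`, so its `q`-expansion is
a multiple of `τ`. -/
lemma coeff_eq_coeff_one_mul_ramanujanTau {F : ℍ → ℂ} (hS : F ∣[(12 : ℤ)] ModularGroup.S = F)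
    (hT : F ∣[(12 : ℤ)] ModularGroup.T = F) (hF : MDiff F) {c : ℕ → ℂ} (hc : c 0 = 0)
    (hsum : ∀ z : ℍ, HasSum (fun m ↦ c m • Function.Periodic.qParam 1 z ^ m) (F z)) (n : ℕ) :
    c n = c 1 * ramanujanTau n := by
  let G : ModularForm 𝒮ℒ 12 :=
    { toFun := F
      slash_action_eq' := by
        rintro _ ⟨A, rfl⟩
        exact SlashInvariantForm.slash_action_generators_SL2Z hS hT A
      holo' := hF
      bdd_at_cusps' := fun hc' ↦ by
        rw [Subgroup.IsArithmetic.isCusp_iff_isCusp_SL2Z] at hc'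
        rw [OnePoint.isBoundedAt_iff_forall_SL2Z hc']
        intro γ _
        rw [SlashInvariantForm.slash_action_generators_SL2Z hS hT]
        exact isBoundedAtImInfty_of_hasSum_qExpansion one_pos hsum }
  have hG (m : ℕ) : c m = (qExpansion 1 G).coeff m :=
    ModularFormClass.qExpansion_coeff_unique one_pos one_mem_strictPeriods_SL hsum m
  obtain ⟨a, ha⟩ := CuspForm.exists_smul_discriminant_of_weight_eq_twelve
    (toCuspForm G ((hG 0).symm.trans hc))
  have hcoe : (G : ℍ → ℂ) = a • (CuspForm.discriminant : ℍ → ℂ) :=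
    (congrArg DFunLike.coe ha).symm
  have hq (m : ℕ) : c m = a * ramanujanTau m := by
    rw [hG, hcoe, ModularForm.qExpansion_smul one_pos one_mem_strictPeriods_SL a
      CuspForm.discriminant, PowerSeries.coeff_smul, CuspForm.coe_discriminant,
      discriminant_qExpansion_coeff, smul_eq_mul]
  rw [hq n, hq 1, ramanujanTau_one]
  simp

section Hecke

open UpperHalfPlane ModularForm MatrixGroups Manifold Matrix

lemma slash_slash_SL_of_mul_eq {k : ℤ} {f : ℍ → ℂ} (hf : ∀ γ : SL(2, ℤ), f ∣[k] γ = f)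
    {α β : GL (Fin 2) ℝ} {γ δ : SL(2, ℤ)}
    (h : (α : Matrix (Fin 2) (Fin 2) ℝ) * (γ : Matrix (Fin 2) (Fin 2) ℤ).map (↑) =
      (δ : Matrix (Fin 2) (Fin 2) ℤ).map (↑) * (β : Matrix (Fin 2) (Fin 2) ℝ)) :
    (f ∣[k] α) ∣[k] γ = f ∣[k] β := by
  have h' : α * SpecialLinearGroup.mapGL ℝ γ = SpecialLinearGroup.mapGL ℝ δ * β :=
    Units.ext <| by simpa using! h
  have hSL (g : ℍ → ℂ) (ε : SL(2, ℤ)) : g ∣[k] ε = g ∣[k] SpecialLinearGroup.mapGL ℝ ε := rfl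
  rw [hSL, ← SlashAction.slash_mul, h', SlashAction.slash_mul, ← hSL, hf]

variable (p : ℕ) [hp : Fact p.Prime]

/-- The matrix `(p 0; 0 1)`. -/
noncomputable def heckeInfty : GL (Fin 2) ℝ :=
  GeneralLinearGroup.mkOfDetNeZero !![(p : ℝ), 0; 0, 1] (by simpa using hp.out.ne_zero)

/-- The matrix `(1 b; 0 p)`. -/
noncomputable def heckeFinite (b : ℤ) : GL (Fin 2) ℝ :=
  GeneralLinearGroup.mkOfDetNeZero !![1, (b : ℝ); 0, p] (by simpa using hp.out.ne_zero)

/-- The Hecke operator at `p` in weight `k`, up to normalization. -/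
noncomputable def heckeSum (k : ℤ) (f : ℍ → ℂ) : ℍ → ℂ :=
  f ∣[k] heckeInfty p + ∑ x : ZMod p, f ∣[k] heckeFinite p x.val

variable {p}

lemma heckeFinite_slash_of_mul_eq_neg_one {k : ℤ} {f : ℍ → ℂ}
    (hf : ∀ γ : SL(2, ℤ), f ∣[k] γ = f) {b c d : ℤ} (h : b * c = -1 + p * d) :
    (f ∣[k] heckeFinite p b) ∣[k] ModularGroup.S = f ∣[k] heckeFinite p c := by
  refine slash_slash_SL_of_mul_eq hf
    (δ := ⟨!![b, -d; p, -c], by rw [det_fin_two_of]; linarith⟩) ?_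
  have h' : (b : ℝ) * c = -1 + p * d := by exact_mod_cast h
  ext i j
  fin_cases i <;> fin_cases j <;>
    simp [heckeFinite, ModularGroup.S, GeneralLinearGroup.mkOfDetNeZero, mul_apply,
      Fin.sum_univ_two]
  · linarith
  · ring

lemma heckeInfty_slash_S {k : ℤ} {f : ℍ → ℂ} (hf : ∀ γ : SL(2, ℤ), f ∣[k] γ = f) :
    (f ∣[k] heckeInfty p) ∣[k] ModularGroup.S = f ∣[k] heckeFinite p 0 := by
  refine slash_slash_SL_of_mul_eq hf (δ := ModularGroup.S) ?_
  ext i j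
  fin_cases i <;> fin_cases j <;>
    simp [heckeFinite, heckeInfty, ModularGroup.S, GeneralLinearGroup.mkOfDetNeZero, mul_apply,
      Fin.sum_univ_two]

lemma heckeFinite_zero_slash_S {k : ℤ} {f : ℍ → ℂ} (hf : ∀ γ : SL(2, ℤ), f ∣[k] γ = f) :
    (f ∣[k] heckeFinite p 0) ∣[k] ModularGroup.S = f ∣[k] heckeInfty p := by
  refine slash_slash_SL_of_mul_eq hf (δ := ModularGroup.S) ?_
  ext i j
  fin_cases i <;> fin_cases j <;>
    simp [heckeFinite, heckeInfty, ModularGroup.S, GeneralLinearGroup.mkOfDetNeZero, mul_apply,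
      Fin.sum_univ_two]

lemma heckeFinite_slash_T {k : ℤ} {f : ℍ → ℂ} (hf : ∀ γ : SL(2, ℤ), f ∣[k] γ = f) (b : ℤ) :
    (f ∣[k] heckeFinite p b) ∣[k] ModularGroup.T = f ∣[k] heckeFinite p (b + 1) := by
  refine slash_slash_SL_of_mul_eq hf (δ := 1) ?_
  ext i j
  fin_cases i <;> fin_cases j <;>
    simp [heckeFinite, ModularGroup.T, GeneralLinearGroup.mkOfDetNeZero, mul_apply,
      Fin.sum_univ_two]
  ring

lemma heckeInfty_slash_T {k : ℤ} {f : ℍ → ℂ} (hf : ∀ γ : SL(2, ℤ), f ∣[k] γ = f) :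
    (f ∣[k] heckeInfty p) ∣[k] ModularGroup.T = f ∣[k] heckeInfty p := by
  have hT := ModularGroup.coe_T_zpow p
  refine slash_slash_SL_of_mul_eq hf (δ := ModularGroup.T ^ (p : ℤ)) ?_
  rw [hT]
  ext i j
  fin_cases i <;> fin_cases j <;>
    simp [heckeInfty, ModularGroup.T, GeneralLinearGroup.mkOfDetNeZero, mul_apply,
      Fin.sum_univ_two]

lemma slash_heckeFinite_congr {k : ℤ} {f : ℍ → ℂ} (hf : ∀ γ : SL(2, ℤ), f ∣[k] γ = f) {b c : ℤ}
    (h : (b : ZMod p) = c) : f ∣[k] heckeFinite p b = f ∣[k] heckeFinite p c := by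
  obtain ⟨d, hd⟩ := ((ZMod.intCast_eq_intCast_iff_dvd_sub b c p).1 h)
  obtain rfl : c = b + p * d := by linarith
  have := slash_slash_SL_of_mul_eq hf (α := heckeFinite p b) (γ := 1)
    (β := heckeFinite p (b + p * d)) (δ := ⟨!![1, -d; 0, 1], by simp⟩) (by
      ext i j
      fin_cases i <;> fin_cases j <;>
        simp [heckeFinite, GeneralLinearGroup.mkOfDetNeZero, mul_apply, Fin.sum_univ_two]
      ring)
  rwa [SlashAction.slash_one] at this

lemma heckeSum_slash_T {k : ℤ} {f : ℍ → ℂ} (hf : ∀ γ : SL(2, ℤ), f ∣[k] γ = f) :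
    heckeSum p k f ∣[k] ModularGroup.T = heckeSum p k f := by
  simp only [heckeSum, SlashAction.add_slash, SlashAction.sum_slash, heckeInfty_slash_T hf,
    heckeFinite_slash_T hf]
  congr 1
  refine Fintype.sum_equiv (Equiv.addRight 1) _ _ fun x ↦ slash_heckeFinite_congr hf ?_
  simp

lemma heckeSum_slash_S {k : ℤ} {f : ℍ → ℂ} (hf : ∀ γ : SL(2, ℤ), f ∣[k] γ = f) :
    heckeSum p k f ∣[k] ModularGroup.S = heckeSum p k f := by
  have hsplit := Finset.add_sum_erase Finset.univ
    (fun x : ZMod p ↦ f ∣[k] heckeFinite p x.val) (Finset.mem_univ 0)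
  simp only [ZMod.val_zero, Nat.cast_zero] at hsplit
  simp only [heckeSum, ← hsplit, SlashAction.add_slash, SlashAction.sum_slash,
    heckeInfty_slash_S hf, heckeFinite_zero_slash_S hf]
  rw [add_left_comm]
  congr 2
  refine Finset.sum_bij' (fun x _ ↦ -x⁻¹) (fun x _ ↦ -x⁻¹) (by simp) (by simp)
    (by simp) (by simp) fun x hx ↦ ?_
  have hx : x ≠ 0 := by simpa using hx
  have : ((x.val * (-x⁻¹ : ZMod p).val : ℤ) : ZMod p) = ((-1 : ℤ) : ZMod p) := by
    push_cast
    simp [hx]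
  obtain ⟨d, hd⟩ := (ZMod.intCast_eq_intCast_iff_dvd_sub _ _ p).1 this
  exact heckeFinite_slash_of_mul_eq_neg_one hf (d := -d) (by linarith)

lemma slash_heckeInfty_apply (k : ℤ) (f : ℍ → ℂ) (z w : ℍ) (hw : (w : ℂ) = p * z) :
    (f ∣[k] heckeInfty p) z = p ^ (k - 1) * f w := by
  have hdet : (heckeInfty p).det.val = p := by
    simp [heckeInfty, GeneralLinearGroup.mkOfDetNeZero]
  have hpos : 0 < (heckeInfty p).det.val := by
    rw [hdet]; exact_mod_cast hp.out.pos
  have hz : heckeInfty p • z = w := by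
    ext
    rw [coe_smul_of_det_pos hpos, hw]
    simp [num, denom, heckeInfty, GeneralLinearGroup.mkOfDetNeZero]
  rw [slash_apply, hz, σ, if_pos hpos, hdet]
  simp [denom, heckeInfty, GeneralLinearGroup.mkOfDetNeZero, mul_comm]

lemma slash_heckeFinite_apply (k : ℤ) (f : ℍ → ℂ) (b : ℤ) (z w : ℍ) (hw : (w : ℂ) = (z + b) / p) :
    (f ∣[k] heckeFinite p b) z = (p : ℂ)⁻¹ * f w := by
  have hdet : (heckeFinite p b).det.val = p := by
    simp [heckeFinite, GeneralLinearGroup.mkOfDetNeZero]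
  have hpos : 0 < (heckeFinite p b).det.val := by
    rw [hdet]; exact_mod_cast hp.out.pos
  have hz : heckeFinite p b • z = w := by
    ext
    rw [coe_smul_of_det_pos hpos, hw]
    simp [num, denom, heckeFinite, GeneralLinearGroup.mkOfDetNeZero]
  have hp0 : (p : ℂ) ≠ 0 := by exact_mod_cast hp.out.ne_zero
  rw [slash_apply, hz, σ, if_pos hpos, hdet]
  simp only [denom, heckeFinite, GeneralLinearGroup.mkOfDetNeZero]
  simp [zpow_sub₀ hp0]
  field_simp

lemma mdifferentiable_heckeSum {k : ℤ} {f : ℍ → ℂ} (hf : MDiff f) : MDiff (heckeSum p k f) :=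
  (hf.slash k _).add (.sum fun _ _ ↦ hf.slash k _)

end Hecke

section HeckeQExpansion

open UpperHalfPlane ModularForm MatrixGroups Function.Periodic

variable {p : ℕ} [hp : Fact p.Prime] {f : ℍ → ℂ} {a : ℕ → ℂ}

lemma hasSum_slash_heckeInfty {k : ℤ}
    (hf : ∀ z : ℍ, HasSum (fun m ↦ a m • qParam 1 z ^ m) (f z)) (z : ℍ) :
    HasSum (fun m ↦ (if p ∣ m then (p : ℂ) ^ (k - 1) * a (m / p) else 0) • qParam 1 z ^ m)
      ((f ∣[k] heckeInfty p) z) := by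
  have hp0 := hp.out.pos
  obtain ⟨w, hw⟩ : ∃ w : ℍ, (w : ℂ) = p * z :=
    ⟨⟨p * z, by simpa using! mul_pos (Nat.cast_pos.2 hp0) z.im_pos⟩, rfl⟩
  rw [slash_heckeInfty_apply k f z w hw,
    ← (mul_right_injective₀ hp0.ne').hasSum_iff (fun m hm ↦ by
      rw [if_neg fun ⟨j, hj⟩ ↦ hm ⟨j, hj.symm⟩, zero_smul])]
  convert! (hf w).mul_left ((p : ℂ) ^ (k - 1)) using 2 with m
  have hq : qParam 1 w = qParam 1 z ^ p := by
    rw [qParam, qParam, hw, ← Complex.exp_nat_mul]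
    congr 1
    ring
  simp [hp0, hq, pow_mul, mul_assoc]

lemma hasSum_sum_slash_heckeFinite {k : ℤ}
    (hf : ∀ z : ℍ, HasSum (fun m ↦ a m • qParam 1 z ^ m) (f z)) (z : ℍ) :
    HasSum (fun m ↦ a (p * m) • qParam 1 z ^ m)
      ((∑ x : ZMod p, f ∣[k] heckeFinite p x.val) z) := by
  have hp0 := hp.out.pos
  have hpC : (p : ℂ) ≠ 0 := by exact_mod_cast hp0.ne'
  have key (x : ZMod p) : HasSum
      (fun m ↦ (p : ℂ)⁻¹ * (a m * (ZMod.stdAddChar (x * (m : ZMod p)) * qParam 1 (z / p) ^ m)))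
      ((f ∣[k] heckeFinite p x.val) z) := by
    obtain ⟨w, hw⟩ : ∃ w : ℍ, (w : ℂ) = (z + (x.val : ℤ)) / p :=
      ⟨⟨(z + (x.val : ℤ)) / p, by
        have : ((z : ℂ) + (x.val : ℤ)) / p = ((p : ℝ)⁻¹ : ℝ) * (z + ((x.val : ℝ) : ℂ)) := by
          push_cast; field_simp
        rw [this, Complex.im_ofReal_mul]
        simpa using! mul_pos (inv_pos.2 (Nat.cast_pos.2 hp0)) z.im_pos⟩, rfl⟩
    rw [slash_heckeFinite_apply k f _ z w hw]
    convert! (hf w).mul_left (p : ℂ)⁻¹ using 4 with m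
    have hx : x * (m : ZMod p) = ((x.val * m : ℤ) : ZMod p) := by simp
    rw [hx, ZMod.stdAddChar_coe, qParam, qParam, hw, ← Complex.exp_nat_mul, ← Complex.exp_nat_mul,
      ← Complex.exp_add]
    congr 1
    push_cast
    field_simp
    ring
  rw [Finset.sum_apply]
  have hsum := hasSum_sum fun (x : ZMod p) (_ : x ∈ Finset.univ) ↦ key x
  have hterm (m : ℕ) : ∑ x : ZMod p,
      (p : ℂ)⁻¹ * (a m * (ZMod.stdAddChar (x * (m : ZMod p)) * qParam 1 (z / p) ^ m)) =
      if p ∣ m then a m * qParam 1 (z / p) ^ m else 0 := by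
    rw [← Finset.mul_sum, ← Finset.mul_sum, ← Finset.sum_mul,
      AddChar.sum_mulShift _ (ZMod.isPrimitive_stdAddChar p), ZMod.card]
    simp only [ZMod.natCast_eq_zero_iff]
    split_ifs
    · field_simp
    · simp
  simp only [hterm] at hsum
  rw [← (mul_right_injective₀ hp0.ne').hasSum_iff (fun m hm ↦ by
      rw [if_neg fun ⟨j, hj⟩ ↦ hm ⟨j, hj.symm⟩])] at hsum
  convert hsum using 2 with m
  have hq : qParam 1 z = qParam 1 (z / p) ^ p := by
    rw [qParam, qParam, ← Complex.exp_nat_mul]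
    congr 1
    field_simp
  simp [hq, pow_mul]

lemma hasSum_heckeSum {k : ℤ}
    (hf : ∀ z : ℍ, HasSum (fun m ↦ a m • qParam 1 z ^ m) (f z)) (z : ℍ) :
    HasSum (fun m ↦ ((if p ∣ m then (p : ℂ) ^ (k - 1) * a (m / p) else 0) + a (p * m)) •
      qParam 1 z ^ m) (heckeSum p k f z) := by
  simp only [add_smul]
  exact (hasSum_slash_heckeInfty hf z).add (hasSum_sum_slash_heckeFinite hf z)

end HeckeQExpansion

@[simp]
lemma ramanujanTau_zero : ramanujanTau 0 = 0 := by simp [ramanujanTau]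

open UpperHalfPlane ModularForm MatrixGroups in
lemma ramanujanTau_prime_mul {p : ℕ} (hp : p.Prime) (n : ℕ) :
    (if p ∣ n then (p : ℤ) ^ 11 * ramanujanTau (n / p) else 0) + ramanujanTau (p * n) =
      ramanujanTau p * ramanujanTau n := by
  have : Fact p.Prime := ⟨hp⟩
  have hinv := SlashInvariantForm.slash_action_generators_SL2Z discriminant_S_invariant
    discriminant_T_invariant
  have hsum (z : ℍ) : HasSum (fun m ↦ (ramanujanTau m : ℂ) • Function.Periodic.qParam 1 z ^ m)
      (discriminant z) := by
    have := ModularForm.hasSum_qExpansion CuspForm.discriminant one_pos one_mem_strictPeriods_SL z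
    simpa only [CuspForm.coe_discriminant, discriminant_qExpansion_coeff] using! this
  have := coeff_eq_coeff_one_mul_ramanujanTau (heckeSum_slash_S (p := p) hinv)
    (heckeSum_slash_T hinv) (mdifferentiable_heckeSum CuspForm.discriminant.holo') (by simp)
    (hasSum_heckeSum hsum) n
  rw [if_neg hp.not_dvd_one, zero_add, mul_one] at this
  rw [show ((12 : ℤ) - 1) = (11 : ℕ) by norm_num, zpow_natCast] at this
  split_ifs at this ⊢ <;> exact_mod_cast this

section RankinCohen

open UpperHalfPlane ModularForm MatrixGroups Function.Periodic Derivative Manifold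

lemma hasSum_normalizedDeriv {F : ℍ → ℂ} {c : ℕ → ℂ}
    (hF : ∀ z : ℍ, HasSum (fun m ↦ c m • qParam 1 z ^ m) (F z)) (z : ℍ) :
    HasSum (fun m ↦ (m * c m) • qParam 1 z ^ m) (D F z) := by
  obtain ⟨y, hy0, hyz⟩ := exists_between z.im_pos
  let U : Set ℂ := {w | y < w.im}
  have hU : IsOpen U := isOpen_lt continuous_const Complex.continuous_im
  let w₀ : ℍ := ⟨y * Complex.I, by simpa using! hy0⟩
  have hw₀ : (w₀ : ℂ) = y * Complex.I := rfl
  have hbound (m : ℕ) (w : ℂ) (hw : w ∈ U) :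
      ‖c m * qParam 1 w ^ m‖ ≤ ‖c m • qParam 1 w₀ ^ m‖ := by
    rw [smul_eq_mul, norm_mul, norm_mul, norm_pow, norm_pow, norm_qParam, norm_qParam]
    have : y < w.im := hw
    gcongr ?_ * ?_ ^ m
    apply Real.exp_le_exp.2
    have h2 : (w₀ : ℂ).im ≤ w.im := by simpa [hw₀] using this.le
    have := mul_le_mul_of_nonneg_left h2 Real.pi_pos.le
    linarith
  have hderiv := Complex.hasSum_deriv_of_summable_norm (hF w₀).summable.norm
    (F := fun m w ↦ c m * qParam 1 w ^ m)
    (fun m ↦ ((differentiable_qParam.pow m).const_mul _).differentiableOn) hU hbound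
    (show (z : ℂ) ∈ U from hyz)
  have heq : deriv (fun w ↦ ∑' m, c m * qParam 1 w ^ m) z = deriv (F ∘ ofComplex) z := by
    refine Filter.EventuallyEq.deriv_eq ?_
    filter_upwards [hU.mem_nhds (show (z : ℂ) ∈ U from hyz)] with w hw
    have hw0 : 0 < w.im := hy0.trans hw
    rw [Function.comp_apply, ofComplex_apply_of_im_pos hw0]
    exact (hF ⟨w, hw0⟩).tsum_eq
  rw [heq] at hderiv
  have hπ : (2 * Real.pi * Complex.I : ℂ) ≠ 0 := Complex.two_pi_I_ne_zero
  convert! hderiv.mul_left (2 * Real.pi * Complex.I : ℂ)⁻¹ using 2 with m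
  have hq : HasDerivAt (qParam 1) (2 * Real.pi * Complex.I * qParam 1 z) z := by
    have := (((hasDerivAt_id (z : ℂ)).const_mul (2 * Real.pi * Complex.I)).div_const
      ((1 : ℝ) : ℂ)).cexp
    have hfun : qParam 1 = fun w ↦ Complex.exp (2 * Real.pi * Complex.I * id w / (1 : ℝ)) := rfl
    rw [hfun]
    convert! this using 1
    simp [mul_comm]
  rw [((hq.fun_pow m).const_mul (c m)).deriv]
  rcases m with _ | m
  · simp
  · simp only [smul_eq_mul, Nat.add_sub_cancel, pow_succ]
    field_simp

lemma HasSum.qExpansion_mul {F G : ℍ → ℂ} {c d : ℕ → ℂ} {z : ℍ}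
    (hF : HasSum (fun m ↦ c m • qParam 1 z ^ m) (F z))
    (hG : HasSum (fun m ↦ d m • qParam 1 z ^ m) (G z)) :
    HasSum (fun m ↦ (∑ x ∈ Finset.HasAntidiagonal.antidiagonal m, c x.1 * d x.2) • qParam 1 z ^ m)
      (F z * G z) := by
  have hs := (summable_norm_sum_mul_antidiagonal_of_summable_norm hF.summable.norm
    hG.summable.norm).of_norm.hasSum
  rw [← tsum_mul_tsum_eq_tsum_sum_antidiagonal_of_summable_norm hF.summable.norm
    hG.summable.norm, hF.tsum_eq, hG.tsum_eq] at hs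
  refine hs.congr_fun fun m ↦ ?_
  rw [Finset.sum_smul]
  refine Finset.sum_congr rfl fun x hx ↦ ?_
  rw [← Finset.HasAntidiagonal.mem_antidiagonal.1 hx, pow_add]
  simp only [smul_eq_mul]
  ring

/-- The first Rankin–Cohen bracket of functions of weights `k` and `l`. -/
noncomputable def rankinCohen (k l : ℤ) (F G : ℍ → ℂ) : ℍ → ℂ :=
  (k : ℂ) • (F * D G) - (l : ℂ) • (G * D F)

lemma rankinCohen_eq_serreDerivative (k l : ℤ) (F G : ℍ → ℂ) :
    rankinCohen k l F G =
      (k : ℂ) • (F * serreDerivative l G) - (l : ℂ) • (G * serreDerivative k F) := by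
  ext z
  simp [rankinCohen]
  ring

lemma rankinCohen_slash {k l : ℤ} {F G : ℍ → ℂ} (hF : MDiff F) (hG : MDiff G) {γ : SL(2, ℤ)}
    (hFγ : F ∣[k] γ = F) (hGγ : G ∣[l] γ = G) :
    rankinCohen k l F G ∣[k + l + 2] γ = rankinCohen k l F G := by
  have h1 : (F * serreDerivative l G) ∣[k + l + 2] γ = F * serreDerivative l G := by
    rw [add_assoc, mul_slash_SL2, hFγ, serreDerivative_slash_invariant hG hGγ]
  have h2 : (G * serreDerivative k F) ∣[k + l + 2] γ = G * serreDerivative k F := by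
    rw [add_comm k, add_assoc, mul_slash_SL2, hGγ, serreDerivative_slash_invariant hF hFγ]
  rw [rankinCohen_eq_serreDerivative, sub_eq_add_neg, SlashAction.add_slash,
    SlashAction.neg_slash, SL_smul_slash, SL_smul_slash, h1, h2]

lemma mdifferentiable_rankinCohen {k l : ℤ} {F G : ℍ → ℂ} (hF : MDiff F) (hG : MDiff G) :
    MDiff (rankinCohen k l F G) :=
  ((hF.mul (normalizedDerivOfComplex_mdifferentiable hG)).const_smul _).sub
    ((hG.mul (normalizedDerivOfComplex_mdifferentiable hF)).const_smul _)

lemma hasSum_rankinCohen {k l : ℤ} {F G : ℍ → ℂ} {c d : ℕ → ℂ}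
    (hF : ∀ z : ℍ, HasSum (fun m ↦ c m • qParam 1 z ^ m) (F z))
    (hG : ∀ z : ℍ, HasSum (fun m ↦ d m • qParam 1 z ^ m) (G z)) (z : ℍ) :
    HasSum (fun m ↦ (k * ∑ x ∈ Finset.HasAntidiagonal.antidiagonal m, c x.1 * (x.2 * d x.2) -
      l * ∑ x ∈ Finset.HasAntidiagonal.antidiagonal m, d x.1 * (x.2 * c x.2)) • qParam 1 z ^ m)
      (rankinCohen k l F G z) := by
  have h := (((hF z).qExpansion_mul (hasSum_normalizedDeriv hG z)).mul_left (k : ℂ)).sub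
    (((hG z).qExpansion_mul (hasSum_normalizedDeriv hF z)).mul_left (l : ℂ))
  refine h.congr_fun fun m ↦ ?_
  simp only [smul_eq_mul]
  ring

end RankinCohen

lemma sum_antidiagonal_ite_add_mul {R : Type*} [CommRing R] (a b : ℕ → R) (n : ℕ) :
    ∑ x ∈ Finset.HasAntidiagonal.antidiagonal n, ((if x.1 = 0 then 1 else 0) + a x.1) * b x.2 =
      b n + ∑ x ∈ Finset.HasAntidiagonal.antidiagonal n, a x.1 * b x.2 := by
  simp only [add_mul, Finset.sum_add_distrib]
  congr 1
  rw [Finset.sum_eq_single (0, n)]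
  · simp
  · rintro ⟨i, j⟩ hx hne
    have hx : i + j = n := by simpa using hx
    have : i ≠ 0 := by
      rintro rfl
      exact hne (by simpa using hx)
    simp [this]
  · simp

open ArithmeticFunction.sigma EisensteinSeries UpperHalfPlane ModularForm MatrixGroups in
lemma E₄_coeff (m : ℕ) :
    (qExpansion 1 E₄).coeff m = (if m = 0 then 1 else 0) + 240 * (σ 3 m : ℂ) := by
  rw [E_qExpansion_coeff _ ⟨2, rfl⟩]
  split_ifs with h
  · simp [h]
  · norm_num [show bernoulli 4 = -1 / 30 by decide +kernel]

open ArithmeticFunction.sigma EisensteinSeries UpperHalfPlane ModularForm MatrixGroups in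
lemma E₆_coeff (m : ℕ) :
    (qExpansion 1 E₆).coeff m = (if m = 0 then 1 else 0) + -504 * (σ 5 m : ℂ) := by
  rw [E_qExpansion_coeff _ ⟨3, rfl⟩]
  split_ifs with h
  · simp [h]
  · norm_num [show bernoulli 6 = 1 / 42 by decide +kernel]

open ArithmeticFunction.sigma EisensteinSeries UpperHalfPlane ModularForm MatrixGroups in
/-- An expression of `τ` through divisor sums, from the Rankin–Cohen bracket of `E₄` and `E₆`. -/
lemma twelve_mul_ramanujanTau (n : ℕ) :
    12 * ramanujanTau n = 7 * n * σ 5 n + 5 * n * σ 3 n + 840 *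
      ∑ x ∈ Finset.HasAntidiagonal.antidiagonal n,
        (x.2 * (2 * σ 3 x.1 * σ 5 x.2 - 3 * σ 5 x.1 * σ 3 x.2) : ℤ) := by
  have hslash (γ : SL(2, ℤ)) : rankinCohen 4 6 E₄ E₆ ∣[(12 : ℤ)] γ = rankinCohen 4 6 E₄ E₆ :=
    rankinCohen_slash E₄.holo' E₆.holo'
      (E₄.slash_action_eq' _ ⟨γ, rfl⟩)
      (E₆.slash_action_eq' _ ⟨γ, rfl⟩)
  have hcoeff (m : ℕ) : (((4 : ℤ) : ℂ) * ∑ x ∈ Finset.HasAntidiagonal.antidiagonal m,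
        (qExpansion 1 E₄).coeff x.1 * (x.2 * (qExpansion 1 E₆).coeff x.2) -
      ((6 : ℤ) : ℂ) * ∑ x ∈ Finset.HasAntidiagonal.antidiagonal m,
        (qExpansion 1 E₆).coeff x.1 * (x.2 * (qExpansion 1 E₄).coeff x.2)) =
      ((-288 * (7 * m * σ 5 m + 5 * m * σ 3 m + 840 *
        ∑ x ∈ Finset.HasAntidiagonal.antidiagonal m,
          (x.2 * (2 * σ 3 x.1 * σ 5 x.2 - 3 * σ 5 x.1 * σ 3 x.2) : ℤ)) : ℤ) : ℂ) := by
    simp only [E₄_coeff, E₆_coeff]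
    rw [sum_antidiagonal_ite_add_mul (fun i ↦ 240 * (σ 3 i : ℂ))
        (fun i ↦ i * ((if i = 0 then 1 else 0) + -504 * (σ 5 i : ℂ))),
      sum_antidiagonal_ite_add_mul (fun i ↦ -504 * (σ 5 i : ℂ))
        (fun i ↦ i * ((if i = 0 then 1 else 0) + 240 * (σ 3 i : ℂ)))]
    have h0 (i : ℕ) : (i : ℂ) * (if i = 0 then 1 else 0) = 0 := by
      split_ifs with h <;> simp [h]
    have hsum : (4 : ℂ) * ∑ x ∈ Finset.HasAntidiagonal.antidiagonal m,
          240 * (σ 3 x.1 : ℂ) * (x.2 * (-504 * (σ 5 x.2 : ℂ))) -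
        6 * ∑ x ∈ Finset.HasAntidiagonal.antidiagonal m,
          -504 * (σ 5 x.1 : ℂ) * (x.2 * (240 * (σ 3 x.2 : ℂ))) =
        -288 * 840 * ∑ x ∈ Finset.HasAntidiagonal.antidiagonal m,
          x.2 * (2 * (σ 3 x.1 : ℂ) * σ 5 x.2 - 3 * σ 5 x.1 * σ 3 x.2) := by
      simp only [Finset.mul_sum, ← Finset.sum_sub_distrib]
      exact Finset.sum_congr rfl fun x _ ↦ by ring
    simp only [mul_add (Nat.cast _ : ℂ), h0, zero_add]
    push_cast
    linear_combination hsum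
  have h := coeff_eq_coeff_one_mul_ramanujanTau (hslash ModularGroup.S) (hslash ModularGroup.T)
    (mdifferentiable_rankinCohen E₄.holo' E₆.holo') (by simp)
    (hasSum_rankinCohen (hasSum_qExpansion E₄ one_pos one_mem_strictPeriods_SL)
      (hasSum_qExpansion E₆ one_pos one_mem_strictPeriods_SL)) n
  rw [hcoeff, hcoeff] at h
  have h1 : (∑ x ∈ Finset.HasAntidiagonal.antidiagonal 1,
      (x.2 * (2 * σ 3 x.1 * σ 5 x.2 - 3 * σ 5 x.1 * σ 3 x.2) : ℤ)) = 0 := by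
    simp [Finset.Nat.antidiagonal_succ]
  rw [h1] at h
  simp only [Nat.cast_one, ArithmeticFunction.sigma_one] at h
  have h := Int.cast_injective (h.trans (Int.cast_mul _ _).symm)
  linarith

section Congruences

open ArithmeticFunction.sigma

lemma sigma_prime {p : ℕ} (hp : p.Prime) (k : ℕ) : σ k p = 1 + p ^ k := by
  simp [ArithmeticFunction.sigma_apply, hp.divisors, hp.one_lt.ne]

lemma ramanujanTau_two : ramanujanTau 2 = -24 := by
  have h := twelve_mul_ramanujanTau 2
  simp [Finset.Nat.antidiagonal_succ, sigma_prime Nat.prime_two] at h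
  lia

lemma ramanujanTau_five : ramanujanTau 5 = 4830 := by
  have h := twelve_mul_ramanujanTau 5
  have h4 (k : ℕ) : σ k 4 = 1 + 2 ^ k + 4 ^ k := by
    simp [ArithmeticFunction.sigma_apply, show Nat.divisors 4 = {1, 2, 4} by decide, add_assoc]
  simp [Finset.Nat.antidiagonal_succ, sigma_prime Nat.prime_two, sigma_prime Nat.prime_three,
    sigma_prime Nat.prime_five, h4] at h
  lia

lemma ramanujanTau_prime_modEq_five {p : ℕ} (hp : p.Prime) :
    ramanujanTau p ≡ p * (1 + p) [ZMOD 5] := by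
  have : Fact (Nat.Prime 5) := ⟨Nat.prime_five⟩
  have h := twelve_mul_ramanujanTau p
  simp only [sigma_prime hp] at h
  obtain ⟨c, hc⟩ : (5 : ℤ) ∣ p ^ 5 - p := by
    refine (ZMod.intCast_zmod_eq_zero_iff_dvd _ 5).1 ?_
    push_cast
    rw [ZMod.pow_card (p := 5), sub_self]
  push_cast at h
  generalize Finset.sum (M := ℤ) (Finset.HasAntidiagonal.antidiagonal p) _ = s at h
  have hco : IsCoprime (5 : ℤ) 12 := by norm_num
  refine Int.modEq_iff_dvd.2 (hco.dvd_of_dvd_mul_left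
    ⟨p ^ 2 - 7 * p * c - p ^ 4 - 168 * s, ?_⟩)
  linear_combination -h - 7 * p * hc

lemma even_ramanujanTau_prime {p : ℕ} (hp : p.Prime) : Even (ramanujanTau p) := by
  obtain rfl | hodd := hp.eq_two_or_odd'
  · rw [ramanujanTau_two]
    decide
  have h := twelve_mul_ramanujanTau p
  simp only [sigma_prime hp] at h
  obtain ⟨c, hc⟩ : (8 : ℤ) ∣ p ^ 2 - 1 :=
    Int.eight_dvd_sq_sub_one_of_odd (by exact_mod_cast hodd)
  push_cast at h
  obtain ⟨d, hd⟩ : Even ((p : ℤ) * (p + 1)) := Int.even_mul_succ_self _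
  have : (8 : ℤ) ∣ 12 * ramanujanTau p := by
    rw [h]
    refine dvd_add ⟨?_, ?_⟩ ((by norm_num : (8 : ℤ) ∣ 840).mul_right _)
    · exact 3 * d + p ^ 2 * c * (7 * p ^ 2 + 7 + 5)
    · linear_combination 12 * hd + p ^ 2 * (7 * p ^ 2 + 7 + 5) * hc
  rw [even_iff_two_dvd]
  lia

end Congruences

lemma ramanujanTau_prime_pow_mul {p m : ℕ} (hp : p.Prime) (hm : ¬ p ∣ m) (n : ℕ) :
    ramanujanTau (p ^ n * m) = lucasU (ramanujanTau p) (p ^ 11) (n + 1) * ramanujanTau m := by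
  induction n using Nat.twoStepInduction with
  | zero => simp
  | one =>
    have := ramanujanTau_prime_mul hp m
    rw [if_neg hm] at this
    simpa [lucasU_add_two] using this
  | more n ih0 ih1 =>
    have := ramanujanTau_prime_mul hp (p ^ (n + 1) * m)
    have hdvd : p ∣ p ^ (n + 1) * m := Dvd.dvd.mul_right (dvd_pow_self p n.succ_ne_zero) m
    have hdiv : p ^ (n + 1) * m / p = p ^ n * m := by
      rw [pow_succ', mul_assoc, Nat.mul_div_cancel_left _ hp.pos]
    rw [if_pos hdvd, hdiv, ← mul_assoc, ← pow_succ', ih0, ih1] at this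
    rw [lucasU_add_two]
    linear_combination this

lemma eq_zero_of_natAbs_lucasU_ramanujanTau_eq {p : ℕ} (hp : p.Prime) {n j : ℕ} (hn : n ≠ 0)
    (h : (lucasU (ramanujanTau p) (p ^ 11) (n + 1)).natAbs = 5 ^ j) : j = 0 := by
  obtain rfl | hp5 := eq_or_ne p 5
  · rw [ramanujanTau_five] at h
    exact absurd h (natAbs_lucasU_at_five_ne_five_pow hn)
  · refine eq_zero_of_natAbs_lucasU_eq_five_pow (mod_cast hp.one_lt) (fun hdvd ↦ hp5 ?_)
      (even_ramanujanTau_prime hp) (ramanujanTau_prime_modEq_five hp) h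
    exact ((Nat.prime_dvd_prime_iff_eq Nat.prime_five hp).1 (mod_cast hdvd)).symm

lemma eq_zero_of_natAbs_ramanujanTau_eq (n : ℕ) :
    ∀ j, (ramanujanTau n).natAbs = 5 ^ j → j = 0 := by
  induction n using Nat.recOnPrimePow with
  | zero => exact fun j hj ↦ absurd hj.symm (by simp)
  | one => exact fun j hj ↦ by simpa [ramanujanTau_one] using hj.symm
  | prime_pow_mul m p n hp hpm hn ih =>
    intro j hj
    rw [ramanujanTau_prime_pow_mul hp hpm, Int.natAbs_mul] at hj
    obtain ⟨s, -, hs⟩ := (Nat.dvd_prime_pow Nat.prime_five).1 (Dvd.intro _ hj)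
    obtain ⟨t, -, ht⟩ := (Nat.dvd_prime_pow Nat.prime_five).1 (Dvd.intro_left _ hj)
    rw [hs, ht, eq_zero_of_natAbs_lucasU_ramanujanTau_eq hp hn.ne' hs, ih t ht] at hj
    simpa using hj.symm

theorem tau_ne_pow_of_five (n : ℕ) (hn : 1 ≤ n) (m : ℕ) (hm : 1 ≤ m) :
    ramanujanTau n ≠ 5 ^ m ∧ ramanujanTau n ≠ -(5 ^ m) := by
  have key : (ramanujanTau n).natAbs ≠ 5 ^ m := fun h ↦
    Nat.one_le_iff_ne_zero.1 hm (eq_zero_of_natAbs_ramanujanTau_eq n m h)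
  refine ⟨fun h ↦ key ?_, fun h ↦ key ?_⟩ <;> simp [h, Int.natAbs_pow]
end

section
/- For every j ∈ {11, 13, 17, 19}, every α ∈ {±31, ±59, ±61, ±79, ±101, ±139, ±149, ±151, ±179, ±191, ±199, ±361}, every odd prime p, and every integer y, we have y² ≠ 5·p^{2j} + 4α. -/
/-- Multiplication by `φ ^ 2` on `ℤ[φ]`, where `(a, b)` stands for `a + b * φ` and `φ` is the
golden ratio. -/
def goldenStep (s : ℤ × ℤ) : ℤ × ℤ := (s.1 + s.2, s.1 + 2 * s.2)

/-- The map `goldenStep` modulo `Q`, on representatives in `[0, Q)`. -/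
def goldenStepMod (Q : ℕ) (s : ℕ × ℕ) : ℕ × ℕ := ((s.1 + s.2) % Q, (s.1 + 2 * s.2) % Q)

/-- The least nonnegative representatives modulo `Q` of a pair of integers. -/
def reduceMod (Q : ℕ) (s : ℤ × ℤ) : ℕ × ℕ := ((s.1 % Q).toNat, (s.2 % Q).toNat)

/-- `b` is even, or for some `q` in `qs` the `((q - 1) / j)`-th power of `b` is neither `0` nor `1`
modulo `q`; the latter certifies that `b` is not a `j`-th power modulo a prime `q ≡ 1 [MOD j]`. -/
def avoidsOddPowers (j : ℕ) (qs : List ℕ) (b : ℕ) : Bool :=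
  b % 2 == 0 || qs.any fun q => 1 < b ^ ((q - 1) / j) % q

/-- The orbit of `s` under `goldenStepMod 2q₁⋯qᵣ` has period dividing `M`, and the `φ`-coordinates
of all its members satisfy `avoidsOddPowers`. -/
def orbitAvoidsOddPowers (j : ℕ) (qs : List ℕ) (M : ℕ) (s : ℕ × ℕ) : Bool :=
  (goldenStepMod (2 * qs.prod))^[M] s == s &&
    (List.iterate (goldenStepMod (2 * qs.prod)) s M).all fun t => avoidsOddPowers j qs t.2

/-- The absolute values of the norms `α` under consideration. -/
def sievedNorms : List ℕ := [31, 59, 61, 79, 101, 139, 149, 151, 179, 191, 199, 361]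

theorem reduceMod_goldenStep (Q : ℕ) [NeZero Q] (s : ℤ × ℤ) :
    reduceMod Q (goldenStep s) = goldenStepMod Q (reduceMod Q s) := by
  have hQ : (Q : ℤ) ≠ 0 := by exact_mod_cast NeZero.ne Q
  have h1 := Int.emod_nonneg s.1 hQ
  have h2 := Int.emod_nonneg s.2 hQ
  have h3 := Int.emod_nonneg (s.1 + s.2) hQ
  have h4 := Int.emod_nonneg (s.1 + 2 * s.2) hQ
  ext
  · zify
    simp only [reduceMod, goldenStep, goldenStepMod]
    push_cast
    rw [Int.toNat_of_nonneg h1, Int.toNat_of_nonneg h2, Int.toNat_of_nonneg h3, ← Int.add_emod]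
  · zify
    simp only [reduceMod, goldenStep, goldenStepMod]
    push_cast
    rw [Int.toNat_of_nonneg h1, Int.toNat_of_nonneg h2, Int.toNat_of_nonneg h4]
    simp [Int.add_emod, Int.mul_emod]

theorem exists_iterate_goldenStep {α B : ℤ} (hB : 0 ≤ B) (hα : 9 * |α| ≤ 5 * B ^ 2) {a b : ℤ}
    (hb : 0 ≤ b) (hab : 0 ≤ 2 * a + b) (h : a ^ 2 + a * b - b ^ 2 = α) :
    ∃ (n : ℕ) (c d : ℤ), 0 ≤ d ∧ d ≤ B ∧ 0 ≤ 2 * c + d ∧ c ^ 2 + c * d - d ^ 2 = α ∧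
      goldenStep^[n] (c, d) = (a, b) := by
  obtain ⟨hα₁, hα₂⟩ := abs_le.1 (show |α| ≤ |α| from le_rfl)
  induction hn : b.toNat using Nat.strong_induction_on generalizing a b with
  | _ m ih =>
    rcases le_or_gt b B with hbB | hbB
    · exact ⟨0, a, b, hb, hbB, hab, h, rfl⟩
    · have hsq : B ^ 2 < b ^ 2 := by nlinarith
      have hy : (2 * a + b) ^ 2 = 5 * b ^ 2 + 4 * α := by rw [← h]; ring
      have h1 : b < 2 * a + b := by nlinarith
      have h2 : a ≤ b := by nlinarith
      have h3 : 0 ≤ 2 * (2 * a - b) + (b - a) := by nlinarith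
      obtain ⟨n, c, d, hd, hdB, hcd, hN, hit⟩ :=
        ih (b - a).toNat (by omega) (by omega) h3 (by rw [← h]; ring) rfl
      refine ⟨n + 1, c, d, hd, hdB, hcd, hN, ?_⟩
      rw [Function.iterate_succ_apply', hit]
      ext <;> simp only [goldenStep] <;> ring

theorem avoidsOddPowers_snd_iterate {j M : ℕ} {qs : List ℕ} (hM : 0 < M)
    (hqs : ∀ q ∈ qs, q.Prime) {s : ℤ × ℤ}
    (h : orbitAvoidsOddPowers j qs M (reduceMod (2 * qs.prod) s)) (n : ℕ) :
    avoidsOddPowers j qs (reduceMod (2 * qs.prod) (goldenStep^[n] s)).2 := by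
  have : NeZero (2 * qs.prod) :=
    ⟨mul_ne_zero two_ne_zero (List.prod_ne_zero fun h0 => Nat.not_prime_zero (hqs 0 h0))⟩
  obtain ⟨hper, hall⟩ : _ ∧ _ := by
    simpa only [orbitAvoidsOddPowers, Bool.and_eq_true, beq_iff_eq, List.all_eq_true] using h
  rw [Function.Semiconj.iterate_right (reduceMod_goldenStep (2 * qs.prod)) n s,
    ← Function.IsPeriodicPt.iterate_mod_apply hper]
  exact hall _ (List.mem_iterate.2 ⟨n % M, Nat.mod_lt _ hM, rfl⟩)

theorem not_avoidsOddPowers_pow {j p : ℕ} {qs : List ℕ} (hp : Odd p)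
    (hqs : ∀ q ∈ qs, q.Prime ∧ j ∣ q - 1) :
    ¬ avoidsOddPowers j qs (p ^ j % (2 * qs.prod)) := by
  simp only [avoidsOddPowers, Bool.or_eq_true, beq_iff_eq, List.any_eq_true, decide_eq_true_eq,
    not_or, not_exists, not_and, not_lt]
  constructor
  · rw [Nat.mod_mul_right_mod]
    have := Nat.odd_iff.1 (hp.pow (n := j))
    omega
  · intro q hq
    obtain ⟨hq', hj⟩ := hqs q hq
    have hdvd : q ∣ 2 * qs.prod := (List.dvd_prod hq).mul_left 2
    rw [Nat.pow_mod, Nat.mod_mod_of_dvd _ hdvd, ← Nat.pow_mod, ← pow_mul, Nat.mul_div_cancel' hj]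
    by_cases hpq : q ∣ p
    · rw [Nat.mod_eq_zero_of_dvd (dvd_pow hpq (Nat.sub_ne_zero_of_lt hq'.one_lt))]
      exact zero_le_one
    · have := Nat.ModEq.pow_totient ((Nat.Prime.coprime_iff_not_dvd hq').2 hpq).symm
      rw [Nat.totient_prime hq'] at this
      rw [this, Nat.mod_eq_of_lt hq'.one_lt]

theorem sq_ne_of_orbitAvoidsOddPowers {j M p : ℕ} {qs : List ℕ} (hM : 0 < M)
    (hqs : ∀ q ∈ qs, q.Prime ∧ j ∣ q - 1)
    (hsieve : ∀ c ∈ Finset.Icc (-13 : ℤ) 34, ∀ d ∈ Finset.Icc (0 : ℤ) 26,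
      (c ^ 2 + c * d - d ^ 2).natAbs ∈ sievedNorms →
        orbitAvoidsOddPowers j qs M (reduceMod (2 * qs.prod) (c, d)))
    {α : ℤ} (hα : α.natAbs ∈ sievedNorms) (hp : Odd p) (y : ℤ) :
    y ^ 2 ≠ 5 * (p : ℤ) ^ (2 * j) + 4 * α := by
  intro hy
  have hαle : |α| ≤ 361 := by
    rw [Int.abs_eq_natAbs]
    exact_mod_cast (by decide : ∀ n ∈ sievedNorms, n ≤ 361) _ hα
  have hpow : Odd ((p : ℤ) ^ j) := (by exact_mod_cast hp : Odd (p : ℤ)).pow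
  have hyb : |y| ^ 2 = 5 * ((p : ℤ) ^ j) ^ 2 + 4 * α := by rw [sq_abs, hy, ← pow_mul, mul_comm j]
  have hy_odd : Odd |y| := by
    rw [← Int.odd_pow' two_ne_zero, hyb]
    exact ((by decide : Odd (5 : ℤ)).mul hpow.pow).add_even ((by decide : Even (4 : ℤ)).mul_right α)
  obtain ⟨a, ha⟩ := even_iff_two_dvd.1 (hy_odd.sub_odd hpow)
  obtain ⟨n, c, d, hd, hd26, hcd, hN, hit⟩ :=
    exists_iterate_goldenStep (α := α) (B := 26) (by norm_num) (by linarith) (a := a)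
      (b := (p : ℤ) ^ j) (by positivity) (by linarith [abs_nonneg y])
      (by rw [show |y| = 2 * a + (p : ℤ) ^ j by linarith] at hyb; linarith)
  have hαle' := (le_abs_self α).trans hαle
  have hc : 2 * c + d ≤ 69 := by nlinarith
  have hc' : c ≤ 34 := by nlinarith
  refine not_avoidsOddPowers_pow hp hqs ?_
  have := avoidsOddPowers_snd_iterate hM (fun q hq => (hqs q hq).1)
    (hsieve c (Finset.mem_Icc.2 ⟨by omega, hc'⟩) d (Finset.mem_Icc.2 ⟨hd, hd26⟩) (hN ▸ hα)) n
  rw [hit] at this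
  simpa only [reduceMod, ← Int.natCast_pow, ← Int.natCast_mod, Int.toNat_natCast] using this

theorem no_points_on_hyperelliptic_curves (j : ℕ) (hj : j ∈ ({11, 13, 17, 19} : Set ℕ))
    (α : ℤ) (hα : α ∈ ({31, -31, 59, -59, 61, -61, 79, -79, 101, -101, 139, -139,
      149, -149, 151, -151, 179, -179, 191, -191, 199, -199, 361, -361} : Set ℤ))
    (p : ℕ) (hp : p.Prime) (hodd : Odd p) (y : ℤ) :
    y ^ 2 ≠ 5 * (p : ℤ) ^ (2 * j) + 4 * α := by
  have hα' : α.natAbs ∈ sievedNorms := by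
    simp only [Set.mem_insert_iff, Set.mem_singleton_iff] at hα
    simp only [sievedNorms, List.mem_cons, List.not_mem_nil]
    omega
  simp only [Set.mem_insert_iff, Set.mem_singleton_iff] at hj
  rcases hj with rfl | rfl | rfl | rfl
  · exact sq_ne_of_orbitAvoidsOddPowers (M := 66) (qs := [89, 9901, 19801]) (by norm_num)
      (by norm_num) (by decide +kernel) hα' hodd y
  · exact sq_ne_of_orbitAvoidsOddPowers (M := 39) (qs := [79, 521, 859]) (by norm_num)
      (by norm_num) (by decide +kernel) hα' hodd y
  · exact sq_ne_of_orbitAvoidsOddPowers (M := 51) (qs := [919, 3469]) (by norm_num)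
      (by norm_num) (by decide +kernel) hα' hodd y
  · exact sq_ne_of_orbitAvoidsOddPowers (M := 57) (qs := [229, 9349, 95419]) (by norm_num)
      (by norm_num) (by decide +kernel) hα' hodd y
end
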